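/- Suppose p = Σ_{k=0}^n c_k·x^k·(x+1)^{n−k}, where c_k ≥ 0 for all 0 ≤ k ≤ n. Then D(p) is real-rooted, A_n ≺ D(p) ≺ d_n, and D(p) ≺ I_n(D(p)). In particular, A_n ≺ d_n. -/

import Mathlib

open Polynomial
open scoped Classical

noncomputable section

/-- The complexification of a real polynomial. -/
def toC (p : ℝ[X]) : ℂ[X] := p.map (algebraMap ℝ ℂ)

/-- A complex polynomial is *stable* if it is identically zero or has no zero with
positive imaginary part. -/
def StableC (f : ℂ[X]) : Prop := f = 0 ∨ ∀ z : ℂ, 0 < z.im → f.eval z ≠ 0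

/-- `Interlaces p q` means `p ≺ q`, i.e. `q + i·p` is stable. -/
def Interlaces (p q : ℝ[X]) : Prop :=
  StableC (toC q + Polynomial.C Complex.I * toC p)

/-- A real polynomial is real-rooted if it is identically zero or all of its complex
zeros are real. -/
def RealRooted (p : ℝ[X]) : Prop :=
  p = 0 ∨ ∀ z : ℂ, (toC p).eval z = 0 → z.im = 0

/-- `Rflip d p = (-1)^d · p(-1-x)`. -/
def Rflip (d : ℕ) (p : ℝ[X]) : ℝ[X] := (-1 : ℝ) ^ d • p.comp (-1 - X)

/-- The f-polynomial of `h` with respect to `d`: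
`f(h;x) = Σ_{k=0}^d h_k x^k (1+x)^{d-k} = (1+x)^d h(x/(1+x))`. -/
def fPoly (d : ℕ) (h : ℝ[X]) : ℝ[X] :=
  ∑ k ∈ Finset.range (d + 1), Polynomial.C (h.coeff k) * X ^ k * (1 + X) ^ (d - k)

/-- The subdivision operator `E`, the unique linear map with `E(binom(x,k)) = x^k`;
here computed via Newton's forward-difference formula
`p = Σ_k (Δ^k p)(0) binom(x,k)` where `Δq = q(x+1) - q(x)`. -/
def subdivE (p : ℝ[X]) : ℝ[X] :=
  ∑ k ∈ Finset.range (p.natDegree + 1),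
    Polynomial.C (((fun q : ℝ[X] => q.comp (X + 1) - q)^[k] p).eval 0) * X ^ k

/-- `Ekd d k = E_k^d = E(x^k (x+1)^(d-k))`. -/
def Ekd (d k : ℕ) : ℝ[X] := subdivE (X ^ k * (X + 1) ^ (d - k))

/-- The cone `𝓔_d` of nonnegative combinations of the `E_k^d`, `0 ≤ k ≤ d`. -/
def coneE (d : ℕ) : Set ℝ[X] :=
  { p | ∃ c : ℕ → ℝ, (∀ i, 0 ≤ c i) ∧ p = ∑ i ∈ Finset.range (d + 1), c i • Ekd d i }

/-- `𝓐_d = {p ∈ 𝓔_d : R_d(p) ≺ p}`. -/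
def Ad (d : ℕ) : Set ℝ[X] := { p | p ∈ coneE d ∧ Interlaces (Rflip d p) p }

/-- `p` is alternatingly increasing with respect to `n`:
`0 ≤ p_0 ≤ p_n ≤ p_1 ≤ p_{n-1} ≤ ⋯ ≤ p_{⌊(n+1)/2⌋}`. -/
def AltInc (n : ℕ) (p : ℝ[X]) : Prop :=
  0 ≤ p.coeff 0 ∧ (∀ k, 2 * k ≤ n → p.coeff k ≤ p.coeff (n - k)) ∧
    (∀ k, 2 * k + 1 ≤ n → p.coeff (n - k) ≤ p.coeff (k + 1))

/-- The number of excedances of an `r`-colored permutation `(σ, z)`: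
indices `k` with `σ k > k`, or `σ k = k` and `z k > 0`. -/
def excC {n r : ℕ} (σ : Equiv.Perm (Fin n)) (z : Fin n → Fin r) : ℕ :=
  (Finset.univ.filter fun k : Fin n => k < σ k ∨ (σ k = k ∧ 0 < (z k : ℕ))).card

/-- The colored Eulerian polynomial `A_{n,r}`. -/
def coloredEulerian (n r : ℕ) : ℝ[X] :=
  ∑ σ : Equiv.Perm (Fin n), ∑ z : Fin n → Fin r, X ^ excC σ z

/-- The colored derangement polynomial `d_{n,r}`: the sum of `x^{exc(σ,z)}` over
colored permutations with no fixed point of color `0`. -/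
def coloredDerangement (n r : ℕ) : ℝ[X] :=
  ∑ σ : Equiv.Perm (Fin n),
    ∑ z ∈ Finset.univ.filter (fun z : Fin n → Fin r => ∀ k, ¬(σ k = k ∧ (z k : ℕ) = 0)),
      X ^ excC σ z

/-- The number of excedances of a permutation. -/
def excP {n : ℕ} (σ : Equiv.Perm (Fin n)) : ℕ :=
  (Finset.univ.filter fun k : Fin n => k < σ k).card

/-- The Eulerian polynomial `A_n`. -/
def eulerianPoly (n : ℕ) : ℝ[X] := ∑ σ : Equiv.Perm (Fin n), X ^ excP σ

/-- The derangement polynomial `d_n`. -/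
def derangePoly (n : ℕ) : ℝ[X] :=
  ∑ σ ∈ Finset.univ.filter (fun σ : Equiv.Perm (Fin n) => ∀ k, σ k ≠ k), X ^ excP σ

/-- The linear map `D` with `D(x^k) = d_k`. -/
def Dmap (p : ℝ[X]) : ℝ[X] :=
  ∑ k ∈ Finset.range (p.natDegree + 1), p.coeff k • derangePoly k

/-- Stability for multivariate complex polynomials: identically zero or nonvanishing
whenever all coordinates have positive imaginary part. -/
def MvStable {n : ℕ} (P : MvPolynomial (Fin n) ℂ) : Prop :=
  P = 0 ∨ ∀ z : Fin n → ℂ, (∀ j, 0 < (z j).im) → MvPolynomial.eval z P ≠ 0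

/-- The operator `T_k(f)(x) = Σ_{i=0}^k (-1)^{k-i} binom(k,i) f((i+1)x)`. -/
def Tk (k : ℕ) (f : ℝ[X]) : ℝ[X] :=
  ∑ i ∈ Finset.range (k + 1),
    ((-1 : ℝ) ^ (k - i) * (k.choose i : ℝ)) • f.comp (Polynomial.C ((i : ℝ) + 1) * X)

/-- The cone `B_{d,γ}` of nonnegative combinations of the polynomials
`x^i (x+1)^{d-i} + x^j (x+1)^{d-j}` with `i + j ≥ γ`. -/
def coneBsum (d γ : ℕ) : Set ℝ[X] :=
  { p | ∃ c : ℕ × ℕ → ℝ, (∀ ij, 0 ≤ c ij) ∧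
      p = ∑ ij ∈ (Finset.range (d + 1) ×ˢ Finset.range (d + 1)).filter
            (fun ij => γ ≤ ij.1 + ij.2),
          c ij • (X ^ ij.1 * (X + 1) ^ (d - ij.1) + X ^ ij.2 * (X + 1) ^ (d - ij.2)) }

/-- The cone `B_{d,m}` of nonnegative combinations of the polynomials
`x^j (mx+1)^{d-j}`, `0 ≤ j ≤ d`. -/
def coneBm (d m : ℕ) : Set ℝ[X] :=
  { p | ∃ c : ℕ → ℝ, (∀ j, 0 ≤ c j) ∧
      p = ∑ j ∈ Finset.range (d + 1), c j • (X ^ j * (Polynomial.C (m : ℝ) * X + 1) ^ (d - j)) }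

end

/-! ### Combinatorics -/

lemma exc_extend {n : ℕ} (s : Finset (Fin n)) (τ : Equiv.Perm (Fin s.card)) :
    excP (τ.extendDomain (s.orderIsoOfFin rfl).toEquiv) = excP τ := by
  unfold excP
  rw [← Finset.card_map (s.orderEmbOfFin rfl).toEmbedding]
  congr 1
  ext k
  simp only [Finset.mem_filter, Finset.mem_univ, true_and, Finset.mem_map]
  constructor
  · intro h
    by_cases hk : k ∈ s
    · obtain ⟨i, hi⟩ := (s.orderIsoOfFin rfl).surjective ⟨k, hk⟩
      have hk' : k = ((s.orderIsoOfFin rfl).toEquiv i : Fin n) := by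
        change k = ((s.orderIsoOfFin rfl) i : Fin n)
        rw [hi]
      refine ⟨i, ?_, ?_⟩
      · rw [hk', Equiv.Perm.extendDomain_apply_image] at h
        exact (s.orderIsoOfFin rfl).lt_iff_lt.1 h
      · rw [hk']; rfl
    · rw [Equiv.Perm.extendDomain_apply_not_subtype _ _ hk] at h
      exact absurd h (lt_irrefl _)
  · rintro ⟨i, hi, rfl⟩
    have : ((s.orderEmbOfFin rfl).toEmbedding i) = ((s.orderIsoOfFin rfl).toEquiv i : Fin n) := rfl
    rw [this, Equiv.Perm.extendDomain_apply_image]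
    exact (s.orderIsoOfFin rfl).lt_iff_lt.2 hi

lemma sum_support_eq {n : ℕ} (s : Finset (Fin n)) :
    ∑ σ ∈ Finset.univ.filter (fun σ : Equiv.Perm (Fin n) =>
      Finset.univ.filter (fun k => σ k ≠ k) = s), (X : ℝ[X]) ^ excP σ
      = derangePoly s.card := by
  unfold derangePoly
  symm
  refine Finset.sum_bij (fun τ _ => τ.extendDomain (s.orderIsoOfFin rfl).toEquiv) ?_ ?_ ?_ ?_
  · intro τ hτ
    simp only [Finset.mem_filter, Finset.mem_univ, true_and] at hτ ⊢
    ext k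
    simp only [Finset.mem_filter, Finset.mem_univ, true_and]
    by_cases hk : k ∈ s
    · simp only [hk, iff_true]
      rw [Equiv.Perm.extendDomain_apply_subtype _ _ hk]
      intro h
      apply hτ ((s.orderIsoOfFin rfl).toEquiv.symm ⟨k, hk⟩)
      apply (s.orderIsoOfFin rfl).toEquiv.injective
      rw [Equiv.apply_symm_apply]
      exact Subtype.ext h
    · simp [hk, Equiv.Perm.extendDomain_apply_not_subtype _ _ hk]
  · intro a _ b _ h
    exact Equiv.Perm.extendDomainHom_injective (s.orderIsoOfFin rfl).toEquiv h
  · intro σ hσ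
    simp only [Finset.mem_filter, Finset.mem_univ, true_and] at hσ
    have hs : ∀ k, k ∈ s ↔ σ k ≠ k := by
      intro k; rw [← hσ]; simp
    have hs' : ∀ k, σ k ∈ s ↔ k ∈ s := by
      intro k; rw [hs, hs]; simp
    refine ⟨(s.orderIsoOfFin rfl).toEquiv.symm.permCongr (σ.subtypePerm hs'), ?_, ?_⟩
    · simp only [Finset.mem_filter, Finset.mem_univ, true_and]
      intro k h
      rw [Equiv.permCongr_apply, Equiv.symm_symm, Equiv.symm_apply_eq] at h
      have := (hs _).1 ((s.orderIsoOfFin rfl).toEquiv k).2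
      exact this (congrArg Subtype.val h)
    · ext k : 1
      by_cases hk : k ∈ s
      · rw [Equiv.Perm.extendDomain_apply_subtype _ _ hk]
        simp [Equiv.permCongr_apply]
      · rw [Equiv.Perm.extendDomain_apply_not_subtype _ _ hk]
        rw [hs] at hk
        simpa using (not_not.1 hk).symm
  · intro τ _
    rw [exc_extend]

lemma eulerian_eq_sum_derange (n : ℕ) :
    eulerianPoly n = ∑ j ∈ Finset.range (n + 1), (n.choose j) • derangePoly j := by
  have h := Finset.sum_powerset_apply_card (x := (Finset.univ : Finset (Fin n))) (fun j => derangePoly j)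
  rw [Finset.card_univ, Fintype.card_fin] at h
  rw [← h, eulerianPoly]
  rw [← Finset.sum_fiberwise_of_maps_to (s := Finset.univ) (t := (Finset.univ : Finset (Fin n)).powerset)
    (g := fun σ : Equiv.Perm (Fin n) => Finset.univ.filter (fun k => σ k ≠ k))]
  · exact Finset.sum_congr rfl fun s _ => by convert sum_support_eq s
  · intro σ _; simp

lemma exc_decomp_zero {n : ℕ} (e : Equiv.Perm (Fin n)) :
    excP (Equiv.Perm.decomposeFin.symm (0, e)) = excP e := by
  unfold excP
  rw [← Finset.card_map (Fin.succEmb n)]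
  congr 1
  ext k
  refine Fin.cases ?_ (fun i => ?_) k
  · simp
  · simp [Equiv.Perm.decomposeFin_symm_apply_succ]

lemma exc_decomp_succ {n : ℕ} (e : Equiv.Perm (Fin n)) (i : Fin n) :
    excP (Equiv.Perm.decomposeFin.symm ((e i).succ, e)) =
      if i < e i then excP e else excP e + 1 := by
  have h : (Finset.univ.filter fun k : Fin (n+1) =>
      k < (Equiv.Perm.decomposeFin.symm ((e i).succ, e)) k) =
      insert 0 (((Finset.univ.filter fun k : Fin n => k < e k).erase i).map (Fin.succEmb n)) := by
    ext k
    refine Fin.cases ?_ (fun j => ?_) k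
    · simp
    · simp only [Finset.mem_filter, Finset.mem_univ, true_and,
        Equiv.Perm.decomposeFin_symm_apply_succ, Finset.mem_insert, Finset.mem_map,
        Finset.mem_erase, Fin.coe_succEmb, Fin.succ_inj]
      by_cases hj : j = i
      · subst hj
        simp
      · rw [Equiv.swap_apply_of_ne_of_ne (Fin.succ_ne_zero _)]
        · simp [hj, Fin.succ_ne_zero]
        · intro h
          exact hj (e.injective (Fin.succ_injective _ h))
  unfold excP
  rw [h, Finset.card_insert_of_notMem, Finset.card_map]
  · split_ifs with hi
    · rw [Finset.card_erase_of_mem (by simpa using hi)]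
      have : 0 < (Finset.univ.filter fun k : Fin n => k < e k).card :=
        Finset.card_pos.2 ⟨i, by simpa using hi⟩
      omega
    · rw [Finset.erase_eq_of_notMem (by simpa using hi)]
  · simp

lemma eulerian_succ (n : ℕ) :
    eulerianPoly (n + 1) = eulerianPoly n + X * ((n : ℝ[X]) * eulerianPoly n)
      + X * (1 - X) * derivative (eulerianPoly n) := by
  have h1 : eulerianPoly (n + 1) = ∑ e : Equiv.Perm (Fin n), (X ^ excP e +
      ∑ i : Fin n, if i < e i then (X : ℝ[X]) ^ excP e else X ^ (excP e + 1)) := by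
    unfold eulerianPoly
    rw [← Equiv.sum_comp (Equiv.Perm.decomposeFin (n := n)).symm, Fintype.sum_prod_type_right]
    refine Finset.sum_congr rfl fun e _ => ?_
    rw [Fin.sum_univ_succ, exc_decomp_zero]
    congr 1
    rw [← Equiv.sum_comp e]
    refine Finset.sum_congr rfl fun i _ => ?_
    rw [exc_decomp_succ]
    split_ifs <;> rfl
  rw [h1]
  unfold eulerianPoly
  rw [derivative_sum, Finset.mul_sum, Finset.mul_sum, Finset.mul_sum, ← Finset.sum_add_distrib,
    ← Finset.sum_add_distrib]
  refine Finset.sum_congr rfl fun e _ => ?_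
  rw [Finset.sum_ite, Finset.sum_const, Finset.sum_const]
  have hc : (Finset.univ.filter fun i : Fin n => i < e i).card = excP e := rfl
  have hc2 : (Finset.univ.filter fun i : Fin n => ¬ i < e i).card + excP e = n := by
    have := Finset.card_filter_add_card_filter_not (s := (Finset.univ : Finset (Fin n))) (fun i => i < e i)
    rw [Finset.card_univ, Fintype.card_fin] at this
    rw [← hc]; omega
  have hc3 : ((Finset.univ.filter fun i : Fin n => ¬ i < e i).card : ℝ[X]) = n - excP e := by
    rw [eq_sub_iff_add_eq]; exact_mod_cast hc2
  have hx : (X : ℝ[X]) * derivative (X ^ excP e : ℝ[X]) = (excP e : ℝ[X]) * X ^ excP e := by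
    rw [derivative_X_pow]
    rcases Nat.eq_zero_or_pos (excP e) with h | h
    · simp [h]
    · obtain ⟨m, hm⟩ := Nat.exists_eq_succ_of_ne_zero h.ne'
      rw [hm]; simp [pow_succ]; ring
  rw [nsmul_eq_mul, nsmul_eq_mul, hc3]
  have hc' : ((Finset.univ.filter fun i : Fin n => i < e i).card : ℝ[X]) = excP e := by
    exact congrArg (fun t : ℕ => (t : ℝ[X])) hc
  linear_combination (1 - X) * -hx + X ^ excP e * hc'

lemma exc_inv {n : ℕ} (σ : Equiv.Perm (Fin n)) (h : ∀ k, σ k ≠ k) :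
    excP σ⁻¹ + excP σ = n := by
  have h1 : excP σ⁻¹ = (Finset.univ.filter fun i : Fin n => ¬ i < σ i).card := by
    unfold excP
    rw [← Finset.card_map (σ⁻¹ : Equiv.Perm (Fin n)).toEmbedding]
    congr 1
    ext k
    simp only [Finset.mem_map, Finset.mem_filter, Finset.mem_univ, true_and, Equiv.coe_toEmbedding]
    constructor
    · rintro ⟨a, ha, rfl⟩
      simpa using ha.le
    · intro hk
      exact ⟨σ k, by simpa using lt_of_le_of_ne (not_lt.1 hk) (h k), by simp⟩
  have := Finset.card_filter_add_card_filter_not (s := (Finset.univ : Finset (Fin n))) (fun i => i < σ i)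
  rw [Finset.card_univ, Fintype.card_fin] at this
  rw [h1]
  have hc : (Finset.univ.filter fun i : Fin n => i < σ i).card = excP σ := rfl
  omega

lemma derange_palin (n : ℕ) (z : ℂ) (hz : z ≠ 0) :
    z ^ n * (toC (derangePoly n)).eval z⁻¹ = (toC (derangePoly n)).eval z := by
  have h : ∀ w : ℂ, (toC (derangePoly n)).eval w =
      ∑ σ ∈ Finset.univ.filter (fun σ : Equiv.Perm (Fin n) => ∀ k, σ k ≠ k), w ^ excP σ := by
    intro w
    simp [toC, derangePoly, Polynomial.map_sum, eval_finsetSum]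
  rw [h, h, Finset.mul_sum]
  refine Finset.sum_bij (fun σ _ => σ⁻¹) ?_ ?_ ?_ ?_
  · intro σ hσ
    simp only [Finset.mem_filter, Finset.mem_univ, true_and] at hσ ⊢
    intro k hk
    apply hσ k
    rw [Equiv.Perm.inv_eq_iff_eq] at hk
    exact hk.symm
  · intro a _ b _ hab
    exact inv_injective hab
  · intro σ hσ
    simp only [Finset.mem_filter, Finset.mem_univ, true_and] at hσ
    refine ⟨σ⁻¹, ?_, by simp⟩
    simp only [Finset.mem_filter, Finset.mem_univ, true_and]
    intro k hk
    apply hσ k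
    rw [Equiv.Perm.inv_eq_iff_eq] at hk
    exact hk.symm
  · intro σ hσ
    simp only [Finset.mem_filter, Finset.mem_univ, true_and] at hσ
    have := exc_inv σ hσ
    have e : z ^ n = z ^ excP σ⁻¹ * z ^ excP σ := by rw [← pow_add, this]
    rw [e, inv_pow, mul_assoc, mul_inv_cancel₀ (pow_ne_zero _ hz), mul_one]

lemma derange_coeff_nonneg (n k : ℕ) : 0 ≤ (derangePoly n).coeff k := by
  unfold derangePoly
  rw [finsetSum_coeff]
  refine Finset.sum_nonneg fun σ _ => ?_
  rw [coeff_X_pow]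
  split_ifs <;> norm_num

lemma eulerian_zero : eulerianPoly 0 = 1 := by
  simp [eulerianPoly, excP]

lemma derange_zero : derangePoly 0 = 1 := by
  simp [derangePoly, excP]

lemma eulerian_coeff_zero (n : ℕ) : (eulerianPoly n).coeff 0 = 1 := by
  induction n with
  | zero => simp [eulerian_zero]
  | succ n ih => rw [eulerian_succ]; simp [ih, mul_assoc]

lemma eulerian_coeff_succ (n k : ℕ) : (eulerianPoly (n + 1)).coeff (k + 1) =
    (k + 2) * (eulerianPoly n).coeff (k + 1) + (n - k) * (eulerianPoly n).coeff k := by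
  have h : eulerianPoly (n + 1) = eulerianPoly n + X * ((n : ℝ[X]) * eulerianPoly n)
      + X * derivative (eulerianPoly n) - X * (X * derivative (eulerianPoly n)) := by
    rw [eulerian_succ]; ring
  rw [h, coeff_sub, coeff_add, coeff_add, coeff_X_mul, coeff_X_mul, coeff_X_mul,
    coeff_natCast_mul, coeff_derivative]
  cases k with
  | zero => simp; ring
  | succ k => rw [coeff_X_mul, coeff_derivative]; push_cast; ring

lemma eulerian_coeff_big (n k : ℕ) (h : n < k + 1) : (eulerianPoly (n + 1)).coeff (k + 0 + 1 - 0) = 0 ∧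
    (eulerianPoly n).coeff (k + 1) = 0 := by
  induction n generalizing k with
  | zero =>
    refine ⟨?_, by simp [eulerian_zero, coeff_one]⟩
    rw [Nat.add_zero, Nat.sub_zero, eulerian_coeff_succ]
    cases k <;> simp [eulerian_zero, coeff_one]
  | succ n ih =>
    obtain ⟨j, rfl⟩ : ∃ j, k = j + 1 := ⟨k - 1, by omega⟩
    have h2 : (eulerianPoly (n + 1)).coeff (j + 1 + 1) = 0 := by simpa using (ih (j + 1) (by omega)).1
    refine ⟨?_, h2⟩
    rw [Nat.add_zero, Nat.sub_zero, eulerian_coeff_succ, h2]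
    have h3 : (eulerianPoly (n + 1)).coeff (j + 1) = 0 := by simpa using (ih j (by omega)).1
    rw [h3]; simp

lemma eulerian_coeff_top (n k : ℕ) (h : n < k + 1) : (eulerianPoly (n + 1)).coeff (k + 1) = 0 := by
  simpa using (eulerian_coeff_big n k h).1

lemma eulerian_natDegree (n : ℕ) : (eulerianPoly (n + 1)).natDegree ≤ n := by
  rw [natDegree_le_iff_coeff_eq_zero]
  intro N hN
  obtain ⟨j, rfl⟩ : ∃ j, N = j + 1 := ⟨N - 1, by omega⟩
  exact eulerian_coeff_top n j (by omega)

lemma eulerian_coeff_symm (n : ℕ) : ∀ k j, k + j = n →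
    (eulerianPoly (n + 1)).coeff k = (eulerianPoly (n + 1)).coeff j := by
  induction n with
  | zero => intro k j h; rw [show k = 0 by omega, show j = 0 by omega]
  | succ n ih =>
    intro k j h
    have key : ∀ m : ℕ, m + 0 = n + 1 →
        (eulerianPoly (n + 2)).coeff m = 1 := by
      intro m hm
      obtain rfl : m = n + 1 := by omega
      rw [eulerian_coeff_succ, eulerian_coeff_top n n (by omega), ih n 0 (by omega),
        eulerian_coeff_zero]
      push_cast; ring
    rcases k with _ | k
    · rw [eulerian_coeff_zero, key j (by omega)]
    rcases j with _ | j
    · rw [eulerian_coeff_zero, key (k + 1) (by omega)]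
    rw [eulerian_coeff_succ (n + 1) k, eulerian_coeff_succ (n + 1) j, ih (k + 1) j (by omega), ih k (j + 1) (by omega)]
    have : (n : ℝ) = k + 1 + j := by exact_mod_cast (show n = k + 1 + j by omega)
    push_cast
    rw [this]; ring

lemma eulerian_palin (n : ℕ) (z : ℂ) (hz : z ≠ 0) :
    z ^ n * (toC (eulerianPoly (n + 1))).eval z⁻¹ = (toC (eulerianPoly (n + 1))).eval z := by
  have hd : (toC (eulerianPoly (n + 1))).natDegree < n + 1 :=
    lt_of_le_of_lt (natDegree_map_le) (Nat.lt_succ_of_le (eulerian_natDegree n))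
  rw [eval_eq_sum_range' hd, eval_eq_sum_range' hd, Finset.mul_sum, ← Finset.sum_range_reflect]
  refine Finset.sum_congr rfl fun k hk => ?_
  have hk' : k ≤ n := Nat.lt_succ_iff.1 (Finset.mem_range.1 hk)
  have e : n + 1 - 1 - k = n - k := by omega
  rw [e]
  have : (toC (eulerianPoly (n + 1))).coeff (n - k) = (toC (eulerianPoly (n + 1))).coeff k := by
    simp only [toC, coeff_map]
    rw [eulerian_coeff_symm n (n - k) k (by omega)]
  rw [this]
  have e2 : z ^ n = z ^ k * z ^ (n - k) := by rw [← pow_add]; congr 1; omega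
  rw [e2, inv_pow]
  field_simp

/-! ### The operator `D` and its recursion -/

/-- `D` as a linear map. -/
noncomputable def Dlin : ℝ[X] →ₗ[ℝ] ℝ[X] :=
  Polynomial.lsum fun k => LinearMap.toSpanSingleton ℝ ℝ[X] (derangePoly k)

lemma Dmap_eq (p : ℝ[X]) : Dmap p = Dlin p := by
  unfold Dmap Dlin
  rw [Polynomial.lsum_apply, Polynomial.sum_over_range]
  · rfl
  · intro n; simp

lemma Dlin_X_pow (k : ℕ) : Dlin (X ^ k) = derangePoly k := by
  unfold Dlin
  rw [Polynomial.lsum_apply, ← monomial_one_right_eq_X_pow, Polynomial.sum_monomial_index]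
  · simp
  · simp

lemma Dlin_X_add_one_pow (n : ℕ) : Dlin ((X + 1) ^ n) = eulerianPoly n := by
  rw [eulerian_eq_sum_derange, add_pow, map_sum]
  refine Finset.sum_congr rfl fun j _ => ?_
  rw [one_pow, mul_one, ← Dlin_X_pow, ← map_nsmul]
  congr 1
  rw [nsmul_eq_mul, mul_comm]

lemma Dlin_rec_aux (p : ℝ[X]) :
    Dlin ((X + 1) * p.comp (X + 1)) = Dlin (p.comp (X + 1))
      + X * Dlin ((X + 1) * derivative (p.comp (X + 1)))
      + X * (1 - X) * derivative (Dlin (p.comp (X + 1))) := by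
  induction p using Polynomial.induction_on' with
  | add p q hp hq =>
    simp only [add_comp, mul_add, map_add] at *
    rw [hp, hq]; ring
  | monomial n a =>
    have e : (monomial n a : ℝ[X]).comp (X + 1) = a • (X + 1) ^ n := by
      simp [Polynomial.smul_eq_C_mul]
    have e2 : (X + 1 : ℝ[X]) * derivative ((X + 1) ^ n) = (n : ℝ) • (X + 1) ^ n := by
      rw [Polynomial.smul_eq_C_mul]
      cases n with
      | zero => simp
      | succ n => simp [derivative_pow]; ring
    rw [e, mul_smul_comm, map_smul, map_smul, derivative_smul, derivative_smul, mul_smul_comm,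
      map_smul, e2, map_smul, ← pow_succ', Dlin_X_add_one_pow, Dlin_X_add_one_pow, eulerian_succ]
    simp only [Polynomial.smul_eq_C_mul, map_natCast]
    ring

lemma Dlin_rec (p : ℝ[X]) :
    Dlin (X * p) = X * Dlin ((X + 1) * derivative p) + X * (1 - X) * derivative (Dlin p) := by
  have h := Dlin_rec_aux (p.comp (X - 1))
  have e : (p.comp (X - 1)).comp (X + 1) = p := by
    rw [comp_assoc]; simp
  rw [e] at h
  have : X * p = (X + 1) * p - p := by ring
  rw [this, map_sub, h]; ring

/-- `g m k = D(x^k (x+1)^m)`. -/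
noncomputable def gP (m k : ℕ) : ℝ[X] := Dlin (X ^ k * (X + 1) ^ m)

lemma gP_zero_left (k : ℕ) : gP 0 k = derangePoly k := by
  simp [gP, Dlin_X_pow]

lemma gP_zero_right (m : ℕ) : gP m 0 = eulerianPoly m := by
  simp [gP, Dlin_X_add_one_pow]

lemma gP_succ_left (m k : ℕ) : gP (m + 1) k = gP m (k + 1) + gP m k := by
  unfold gP
  rw [← map_add]; congr 1; ring

lemma gP_rec (m k : ℕ) : gP m (k + 1) =
    X * (((m + k : ℕ) : ℝ[X]) * gP m k) + X * (1 - X) * derivative (gP m k)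
      + X * ((k : ℝ[X]) * gP m (k - 1)) := by
  have h := Dlin_rec (X ^ k * (X + 1) ^ m)
  have e : (X + 1) * derivative (X ^ k * (X + 1) ^ m : ℝ[X]) =
      ((m + k : ℕ) : ℝ) • (X ^ k * (X + 1) ^ m) + (k : ℝ) • (X ^ (k - 1) * (X + 1) ^ m) := by
    simp only [Polynomial.smul_eq_C_mul, map_natCast]
    cases k with
    | zero =>
      cases m with
      | zero => simp
      | succ m => simp [derivative_pow]; ring
    | succ k =>
      cases m with
      | zero => simp [derivative_pow]; ring
      | succ m => simp [derivative_pow]; ring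
  rw [e, map_add, map_smul, map_smul] at h
  unfold gP
  rw [show (X : ℝ[X]) ^ (k + 1) * (X + 1) ^ m = X * (X ^ k * (X + 1) ^ m) by ring, h]
  simp only [Polynomial.smul_eq_C_mul, map_natCast]
  ring

lemma gP_coeff_nonneg (m : ℕ) : ∀ k i, 0 ≤ (gP m k).coeff i := by
  induction m with
  | zero => intro k i; rw [gP_zero_left]; exact derange_coeff_nonneg k i
  | succ m ih =>
    intro k i
    rw [gP_succ_left, coeff_add]
    exact add_nonneg (ih _ _) (ih _ _)

lemma gP_natDegree_aux (m : ℕ) : ∀ k, 1 ≤ m + k → ∀ i, m + k ≤ i → (gP m k).coeff i = 0 := by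
  intro k
  induction k generalizing m with
  | zero =>
    intro h i hi
    obtain ⟨m, rfl⟩ : ∃ j, m = j + 1 := ⟨m - 1, by omega⟩
    rw [gP_zero_right]
    exact coeff_eq_zero_of_natDegree_lt (lt_of_le_of_lt (eulerian_natDegree m) (by omega))
  | succ k ih =>
    intro h i hi
    have h1 := ih (m + 1) (by omega) i (by omega)
    rw [gP_succ_left, coeff_add] at h1
    have h2 := gP_coeff_nonneg m k i
    have h3 := gP_coeff_nonneg m (k + 1) i
    linarith

lemma gP_natDegree (m k : ℕ) (h : 1 ≤ m + k) : (gP m k).natDegree ≤ m + k - 1 := by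
  rw [natDegree_le_iff_coeff_eq_zero]
  intro N hN
  exact gP_natDegree_aux m k h N (by omega)

lemma derange_one : derangePoly 1 = 0 := by
  have := gP_rec 0 0
  rw [gP_zero_left, gP_zero_left, derange_zero] at this
  simpa using this

lemma derange_two : derangePoly 2 = X := by
  have := gP_rec 0 1
  rw [gP_zero_left, gP_zero_left, derange_one, gP_zero_left, Nat.sub_self, derange_zero] at this
  simpa using this

lemma eulerian_one : eulerianPoly 1 = 1 := by
  rw [eulerian_succ, eulerian_zero]; simp

/-! ### Logarithmic derivatives and the interlacing recursion -/

lemma toC_eval (p : ℝ[X]) (z : ℂ) : (toC p).eval z = aeval z p := by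
  rw [toC, eval_map_algebraMap]

/-- Nonnegative coefficients and no zeros in the open upper half plane. -/
def GoodP (p : ℝ[X]) : Prop :=
  (∀ i, 0 ≤ p.coeff i) ∧ ∀ z : ℂ, 0 < z.im → aeval z p ≠ 0

lemma GoodP.ne_zero {p : ℝ[X]} (h : GoodP p) : p ≠ 0 := by
  rintro rfl
  exact h.2 Complex.I (by simp) (by simp)

lemma eval_pos_of_nonneg {p : ℝ[X]} (h : ∀ i, 0 ≤ p.coeff i) (h0 : p ≠ 0) {x : ℝ} (hx : 0 < x) :
    0 < p.eval x := by
  rw [eval_eq_sum_range]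
  refine Finset.sum_pos' (fun i _ => mul_nonneg (h i) (pow_nonneg hx.le i))
    ⟨p.natDegree, by simp, mul_pos (lt_of_le_of_ne (h _) ?_) (pow_pos hx _)⟩
  exact fun h1 => h0 (leadingCoeff_eq_zero.1 h1.symm)

lemma aeval_ofReal' (p : ℝ[X]) (x : ℝ) : aeval (x : ℂ) p = ((p.eval x : ℝ) : ℂ) := by
  have := Polynomial.aeval_algebraMap_apply ℂ x p
  simpa using this

lemma GoodP.root {p : ℝ[X]} (h : GoodP p) {r : ℂ} (hr : aeval r p = 0) : r.im = 0 ∧ r.re ≤ 0 := by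
  have h1 : r.im = 0 := by
    rcases lt_trichotomy r.im 0 with h1 | h1 | h1
    · exfalso
      apply h.2 ((starRingEnd ℂ) r) (by simpa using h1)
      rw [Polynomial.aeval_conj, hr, map_zero]
    · exact h1
    · exact absurd hr (h.2 r h1)
  refine ⟨h1, ?_⟩
  by_contra h2
  push Not at h2
  have e : r = (r.re : ℂ) := Complex.ext (by simp) (by simp [h1])
  rw [e, aeval_ofReal'] at hr
  have := eval_pos_of_nonneg h.1 h.ne_zero h2
  have h3 : p.eval r.re = 0 := by exact_mod_cast hr
  linarith

lemma root_bound_a (z r : ℂ) (hz : 0 < z.im) (h1 : r.im = 0) (h2 : r.re ≤ 0) :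
    -z.im ≤ (z * (1 - z) * (1 / (z - r))).im ∧ ((1 - z) * (1 / (z - r))).im ≤ 0 := by
  have e : r = (r.re : ℂ) := Complex.ext (by simp) (by simp [h1])
  set x := r.re with hx
  rw [e]
  have hne : z - (x : ℂ) ≠ 0 := by
    intro h
    have := congrArg Complex.im h
    simp at this
    linarith
  have hI : (1 / (z - (x : ℂ))).im ≤ 0 := by
    rw [one_div, Complex.inv_im]
    apply div_nonpos_of_nonpos_of_nonneg _ (Complex.normSq_nonneg _)
    simp; exact hz.le
  have e1 : z * (1 - z) * (1 / (z - (x : ℂ))) =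
      -z + ((1 - x : ℝ) : ℂ) + ((x * (1 - x) : ℝ) : ℂ) * (1 / (z - (x : ℂ))) := by
    field_simp
    push_cast
    ring
  have e2 : (1 - z) * (1 / (z - (x : ℂ))) =
      ((-1 : ℝ) : ℂ) + ((1 - x : ℝ) : ℂ) * (1 / (z - (x : ℂ))) := by
    field_simp
    push_cast
    ring
  rw [e1, e2]
  simp only [Complex.add_im, Complex.neg_im, Complex.ofReal_im, Complex.im_ofReal_mul]
  constructor
  · have : x * (1 - x) ≤ 0 := by nlinarith
    nlinarith
  · have : 0 ≤ 1 - x := by linarith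
    nlinarith

lemma root_bound_sum (z : ℂ) (hz : 0 < z.im) (s : Multiset ℂ)
    (hs : ∀ r ∈ s, r.im = 0 ∧ r.re ≤ 0) :
    -((Multiset.card s : ℝ) * z.im) ≤ (z * (1 - z) * (s.map fun r => 1 / (z - r)).sum).im ∧
      ((1 - z) * (s.map fun r => 1 / (z - r)).sum).im ≤ 0 := by
  induction s using Multiset.induction_on with
  | empty => simp
  | cons r s ih =>
    obtain ⟨h1, h2⟩ := ih fun r hr => hs r (Multiset.mem_cons_of_mem hr)
    have h3 := hs r (Multiset.mem_cons_self r s)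
    obtain ⟨h4, h5⟩ := root_bound_a z r hz h3.1 h3.2
    rw [Multiset.map_cons, Multiset.sum_cons, mul_add, mul_add, Complex.add_im, Complex.add_im,
      Multiset.card_cons]
    push_cast
    constructor <;> linarith

lemma GoodP.logderiv {p : ℝ[X]} (h : GoodP p) (e : ℕ) (he : p.natDegree ≤ e) (z : ℂ)
    (hz : 0 < z.im) :
    -((e : ℝ) * z.im) ≤ (z * (1 - z) * (aeval z (derivative p) / aeval z p)).im ∧
      ((1 - z) * (aeval z (derivative p) / aeval z p)).im ≤ 0 := by
  have hne : (toC p).eval z ≠ 0 := by rw [toC_eval]; exact h.2 z hz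
  have h1 := (IsAlgClosed.splits (toC p)).eval_derivative_div_eval_of_ne_zero hne
  have h2 : derivative (toC p) = toC (derivative p) := by
    simp [toC, derivative_map]
  rw [h2, toC_eval, toC_eval] at h1
  rw [h1]
  obtain ⟨h3, h4⟩ := root_bound_sum z hz (toC p).roots (by
    intro r hr
    apply h.root
    rw [← toC_eval]
    exact (mem_roots'.1 hr).2)
  refine ⟨le_trans ?_ h3, h4⟩
  have h5 : Multiset.card (toC p).roots ≤ e :=
    le_trans (card_roots' _) (le_trans natDegree_map_le he)
  have h6 : (Multiset.card (toC p).roots : ℝ) ≤ e := by exact_mod_cast h5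
  nlinarith

/-- The inductive package. -/
def PkP (m k : ℕ) : Prop :=
  GoodP (gP m k) ∧ ∀ z : ℂ, 0 < z.im →
    ((k : ℂ) * aeval z (gP m (k - 1)) / aeval z (gP m k)).im ≤ 0 ∧
    0 ≤ (z * ((k : ℂ) * aeval z (gP m (k - 1)) / aeval z (gP m k))).im

lemma PkP.ratio {m k : ℕ} (hmk : 1 ≤ m + k) (h : PkP m k) (z : ℂ) (hz : 0 < z.im) :
    0 < (aeval z (gP m (k + 1)) / aeval z (gP m k)).im ∧
    (aeval z (gP m (k + 1)) / aeval z (gP m k) / z).im ≤ 0 := by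
  obtain ⟨hg, hw⟩ := h
  obtain ⟨hw1, hw2⟩ := hw z hz
  obtain ⟨hl1, hl2⟩ := hg.logderiv (m + k - 1) (gP_natDegree m k hmk) z hz
  have hz0 : z ≠ 0 := by rintro rfl; simp at hz
  have hne := hg.2 z hz
  have e1 : aeval z (gP m (k + 1)) / aeval z (gP m k) =
      (((m + k : ℕ) : ℝ) : ℂ) * z
      + z * (1 - z) * (aeval z (derivative (gP m k)) / aeval z (gP m k))
      + z * ((k : ℂ) * aeval z (gP m (k - 1)) / aeval z (gP m k)) := by
    rw [gP_rec]
    simp only [map_add, map_mul, aeval_X, map_natCast, map_sub, map_one]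
    field_simp
    push_cast
    ring
  have e2 : aeval z (gP m (k + 1)) / aeval z (gP m k) / z =
      (((m + k : ℕ) : ℝ) : ℂ)
      + (1 - z) * (aeval z (derivative (gP m k)) / aeval z (gP m k))
      + ((k : ℂ) * aeval z (gP m (k - 1)) / aeval z (gP m k)) := by
    rw [e1]
    field_simp
  rw [e2, e1]
  simp only [Complex.add_im, Complex.ofReal_im, Complex.im_ofReal_mul]
  have hc : ((m + k - 1 : ℕ) : ℝ) = ((m + k : ℕ) : ℝ) - 1 := by
    rw [Nat.cast_sub hmk]; simp
  rw [hc] at hl1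
  constructor
  · nlinarith
  · linarith

lemma im_inv_nonneg {w : ℂ} (h : w.im ≤ 0) : 0 ≤ (w⁻¹).im := by
  rw [Complex.inv_im]
  exact div_nonneg (by linarith) (Complex.normSq_nonneg _)

lemma im_inv_nonpos {w : ℂ} (h : 0 ≤ w.im) : (w⁻¹).im ≤ 0 := by
  rw [Complex.inv_im]
  exact div_nonpos_of_nonpos_of_nonneg (by linarith) (Complex.normSq_nonneg _)

lemma PkP.succ {m k : ℕ} (hmk : 1 ≤ m + k) (h : PkP m k) : PkP m (k + 1) := by
  refine ⟨⟨gP_coeff_nonneg m (k + 1), ?_⟩, ?_⟩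
  · intro z hz h0
    have := (h.ratio hmk z hz).1
    rw [h0] at this
    simp at this
  · intro z hz
    obtain ⟨h1, h2⟩ := h.ratio hmk z hz
    have e1 : ((k + 1 : ℕ) : ℂ) * aeval z (gP m (k + 1 - 1)) / aeval z (gP m (k + 1)) =
      (((k + 1 : ℕ) : ℝ) : ℂ) * (aeval z (gP m (k + 1)) / aeval z (gP m k))⁻¹ := by
      rw [inv_div, Nat.add_sub_cancel]; push_cast; ring
    have e2 : z * (((k + 1 : ℕ) : ℂ) * aeval z (gP m (k + 1 - 1)) / aeval z (gP m (k + 1))) =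
      (((k + 1 : ℕ) : ℝ) : ℂ) * (aeval z (gP m (k + 1)) / aeval z (gP m k) / z)⁻¹ := by
      rw [e1]; simp only [div_eq_mul_inv, mul_inv, inv_inv]; ring
    rw [e2, e1, Complex.im_ofReal_mul, Complex.im_ofReal_mul]
    have := im_inv_nonpos h1.le
    have := im_inv_nonneg h2
    have hk : (0 : ℝ) ≤ ((k + 1 : ℕ) : ℝ) := by positivity
    constructor
    · nlinarith
    · positivity

lemma PkP.zero {m : ℕ} (h : GoodP (eulerianPoly m)) : PkP m 0 := by
  refine ⟨by rwa [gP_zero_right], ?_⟩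
  intro z _
  simp

lemma good_eulerian (m : ℕ) : GoodP (eulerianPoly (m + 1)) := by
  induction m with
  | zero =>
    rw [eulerian_one]
    refine ⟨fun i => ?_, fun z _ => by simp⟩
    rw [coeff_one]; split_ifs <;> norm_num
  | succ m ih =>
    refine ⟨fun i => ?_, fun z hz h0 => ?_⟩
    · rw [← gP_zero_right]; exact gP_coeff_nonneg _ _ _
    · have h1 := ((PkP.zero ih).ratio (by omega) z hz).1
      rw [← gP_zero_right, gP_succ_left, map_add, add_eq_zero_iff_eq_neg] at h0
      have hne := (PkP.zero ih).1.2 z hz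
      rw [h0, neg_div, div_self hne] at h1
      simp at h1

lemma pkP_main (m k : ℕ) (h : 1 ≤ m ∨ 2 ≤ k) : PkP m k := by
  rcases m with _ | m
  · have hk : 2 ≤ k := by omega
    induction k, hk using Nat.le_induction with
    | base =>
      refine ⟨⟨gP_coeff_nonneg _ _, ?_⟩, ?_⟩
      · intro z hz
        rw [gP_zero_left, derange_two, aeval_X]
        rintro rfl; simp at hz
      · intro z _
        simp [gP_zero_left, derange_one]
    | succ k hk ih => exact (ih (Or.inr hk)).succ (by omega)
  · clear h
    induction k with
    | zero => exact PkP.zero (good_eulerian m)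
    | succ k ih => exact ih.succ (by omega)

/-- Consecutive interlacing of `q_{n,k} = g_{n-k,k}`. -/
lemma consec (m k : ℕ) (h : 1 ≤ m + k) (z : ℂ) (hz : 0 < z.im) :
    0 < (aeval z (gP m (k + 1)) / aeval z (gP (m + 1) k)).im ∨
      aeval z (gP m (k + 1)) / aeval z (gP (m + 1) k) = 1 := by
  by_cases hmk : 1 ≤ m ∨ 2 ≤ k
  · left
    have hp := pkP_main m k hmk
    have h1 := (hp.ratio h z hz).1
    have hne := hp.1.2 z hz
    have hne2 := (hp.succ h).1.2 z hz
    set R := aeval z (gP m (k + 1)) / aeval z (gP m k) with hR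
    have hR0 : R ≠ 0 := by intro h; rw [h] at h1; simp at h1
    have e : aeval z (gP m (k + 1)) / aeval z (gP (m + 1) k) = (1 + R⁻¹)⁻¹ := by
      rw [gP_succ_left, map_add, hR, inv_div, ← div_self hne2, ← add_div, inv_div]
    have h2 : (1 + R⁻¹).im < 0 := by
      simp only [Complex.add_im, Complex.one_im, zero_add, Complex.inv_im]
      exact div_neg_of_neg_of_pos (by linarith) (Complex.normSq_pos.2 hR0)
    rw [e, Complex.inv_im]
    refine div_pos (by linarith) (Complex.normSq_pos.2 ?_)
    intro h3; rw [h3] at h2; simp at h2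
  · right
    obtain rfl : m = 0 := by omega
    obtain rfl : k = 1 := by omega
    rw [gP_succ_left, gP_zero_left, gP_zero_left, derange_one, add_zero]
    apply div_self
    rw [derange_two, aeval_X]
    rintro rfl; simp at hz

/-! ### The argument chain -/

/-- Upper half plane together with the positive real axis. -/
def UU : Set ℂ := {z | 0 < z.im ∨ (z.im = 0 ∧ 0 < z.re)}

lemma UU_convex : Convex ℝ UU := by
  intro z hz w hw a b ha hb hab
  simp only [UU, Set.mem_ofPred_eq, Complex.add_im, Complex.smul_im, Complex.add_re,
    Complex.smul_re, smul_eq_mul] at *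
  rcases ha.eq_or_lt with rfl | ha
  · obtain rfl : b = 1 := by linarith
    simpa using hw
  rcases hb.eq_or_lt with rfl | hb
  · obtain rfl : a = 1 := by linarith
    simpa using hz
  rcases hz with hz | ⟨hz, hz'⟩ <;> rcases hw with hw | ⟨hw, hw'⟩
  · left; positivity
  · left; rw [hw]; simp; positivity
  · left; rw [hz]; simp; positivity
  · right; rw [hz, hw]; simp; positivity

lemma UU_slit {z : ℂ} (hz : z ∈ UU) : z ∈ Complex.slitPlane := by
  rcases hz with h | ⟨_, h⟩
  · exact Or.inr h.ne'
  · exact Or.inl h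

lemma UU_ne {z : ℂ} (hz : z ∈ UU) : z ≠ 0 := Complex.slitPlane_ne_zero (UU_slit hz)

lemma UU_arg {z : ℂ} (hz : z ∈ UU) : 0 ≤ Complex.arg z ∧ Complex.arg z < Real.pi := by
  constructor
  · rw [Complex.arg_nonneg_iff]
    rcases hz with h | ⟨h, _⟩
    · exact h.le
    · exact h.ge
  · exact lt_of_le_of_ne (Complex.arg_le_pi z) (Complex.mem_slitPlane_iff_arg.1 (UU_slit hz)).1

lemma UU_of_exp {c φ : ℝ} (hc : 0 < c) (h0 : 0 ≤ φ) (h1 : φ < Real.pi) :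
    (c : ℂ) * Complex.exp (φ * Complex.I) ∈ UU := by
  rcases h0.eq_or_lt with rfl | h0
  · right; simp [hc]
  · left
    rw [Complex.im_ofReal_mul, Complex.exp_ofReal_mul_I_im]
    exact mul_pos hc (Real.sin_pos_of_pos_of_lt_pi h0 h1)

/-- `1 / conj z`. -/
noncomputable def wP (z : ℂ) : ℂ := ((starRingEnd ℂ) z)⁻¹

lemma wP_UU {z : ℂ} (hz : z ∈ UU) : wP z ∈ UU := by
  have hn : 0 < Complex.normSq z := Complex.normSq_pos.2 (UU_ne hz)
  simp only [UU, wP, Set.mem_ofPred_eq, Complex.inv_im, Complex.inv_re, Complex.conj_im,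
    Complex.conj_re, Complex.normSq_conj, neg_neg] at *
  rcases hz with h | ⟨h, h'⟩
  · left; positivity
  · right; rw [h]; simp; positivity

section chain

variable (n : ℕ) (Q : ℕ → ℝ[X])

/-- ratio of consecutive polynomials -/
noncomputable def rP (k : ℕ) (z : ℂ) : ℂ := aeval z (Q (k + 1)) / aeval z (Q k)

/-- sum of arguments -/
noncomputable def sP (j k : ℕ) (z : ℂ) : ℝ := ∑ i ∈ Finset.Ico j k, Complex.arg (rP Q i z)

variable {n Q}
variable (hpos : ∀ k ≤ n, ∀ x : ℝ, 0 < x → 0 < (Q k).eval x)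
  (hne : ∀ k ≤ n, ∀ z : ℂ, 0 < z.im → aeval z (Q k) ≠ 0)
  (hr : ∀ k < n, ∀ z : ℂ, 0 < z.im → 0 < (aeval z (Q (k + 1)) / aeval z (Q k)).im ∨
    aeval z (Q (k + 1)) / aeval z (Q k) = 1)
  (hQn : ∀ z : ℂ, z ≠ 0 → z ^ n * aeval z⁻¹ (Q n) = aeval z (Q n))
  (hQ0 : ∀ z : ℂ, z ≠ 0 → z ^ (n - 1) * aeval z⁻¹ (Q 0) = aeval z (Q 0))

include hpos in
lemma aeval_real_pos {k : ℕ} (hk : k ≤ n) {z : ℂ} (h1 : z.im = 0) (h2 : 0 < z.re) :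
    ∃ c : ℝ, 0 < c ∧ aeval z (Q k) = (c : ℂ) := by
  have e : z = (z.re : ℂ) := Complex.ext (by simp) (by simp [h1])
  refine ⟨(Q k).eval z.re, hpos k hk _ h2, ?_⟩
  conv_lhs => rw [e]
  exact aeval_ofReal' _ _

include hpos hne in
lemma aeval_ne_UU {k : ℕ} (hk : k ≤ n) {z : ℂ} (hz : z ∈ UU) : aeval z (Q k) ≠ 0 := by
  rcases hz with h | ⟨h1, h2⟩
  · exact hne k hk z h
  · obtain ⟨c, hc, e⟩ := aeval_real_pos hpos hk h1 h2
    rw [e]; exact_mod_cast hc.ne'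

include hpos hr in
lemma rP_UU {k : ℕ} (hk : k < n) {z : ℂ} (hz : z ∈ UU) : rP Q k z ∈ UU := by
  unfold rP
  rcases hz with h | ⟨h1, h2⟩
  · rcases hr k hk z h with h | h
    · exact Or.inl h
    · rw [h]; right; simp
  · obtain ⟨c, hc, e⟩ := aeval_real_pos hpos hk.le h1 h2
    obtain ⟨c', hc', e'⟩ := aeval_real_pos hpos (Nat.succ_le_of_lt hk) h1 h2
    rw [e, e', ← Complex.ofReal_div]
    right; simp; positivity

include hpos hr in
lemma sP_nonneg {j k : ℕ} (hk : k ≤ n) {z : ℂ} (hz : z ∈ UU) : 0 ≤ sP Q j k z := by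
  refine Finset.sum_nonneg fun i hi => ?_
  have := (Finset.mem_Ico.1 hi).2
  exact (UU_arg (rP_UU hpos hr (by omega) hz)).1

include hpos hr in
lemma sP_le {j k : ℕ} (hk : k ≤ n) {z : ℂ} (hz : z ∈ UU) : sP Q j k z ≤ sP Q 0 n z := by
  refine Finset.sum_le_sum_of_subset_of_nonneg ?_ ?_
  · intro i hi
    rw [Finset.mem_Ico] at *
    omega
  · intro i hi _
    exact (UU_arg (rP_UU hpos hr (Finset.mem_Ico.1 hi).2 hz)).1

include hpos hne in
lemma sP_exp {j k : ℕ} (hjk : j ≤ k) (hk : k ≤ n) {z : ℂ} (hz : z ∈ UU) :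
    ∃ c : ℝ, 0 < c ∧ aeval z (Q k) = (c : ℂ) * Complex.exp (sP Q j k z * Complex.I) * aeval z (Q j) := by
  induction k, hjk using Nat.le_induction with
  | base => exact ⟨1, one_pos, by simp [sP]⟩
  | succ k hjk ih =>
    obtain ⟨c, hc, e⟩ := ih (by omega)
    have h1 := aeval_ne_UU hpos hne (show k ≤ n by omega) hz
    have h2 := aeval_ne_UU hpos hne hk hz
    have h3 : rP Q k z ≠ 0 := div_ne_zero h2 h1
    refine ⟨‖rP Q k z‖ * c, by positivity, ?_⟩
    have h4 := Complex.norm_mul_exp_arg_mul_I (rP Q k z)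
    have h5 : aeval z (Q (k + 1)) = rP Q k z * aeval z (Q k) := by
      unfold rP; field_simp
    have h6 : sP Q j (k + 1) z = sP Q j k z + Complex.arg (rP Q k z) := by
      unfold sP; rw [Finset.sum_Ico_succ_top hjk]
    rw [h5, h6, e]
    conv_lhs => rw [← h4]
    push_cast
    rw [add_mul, Complex.exp_add]
    ring

lemma aeval_cont (p : ℝ[X]) : Continuous fun z : ℂ => aeval z p := by
  have : (fun z : ℂ => aeval z p) = fun z => (toC p).eval z := by
    funext z; rw [toC_eval]
  rw [this]
  exact (toC p).continuous

include hpos hne hr in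
lemma sP_cont : ContinuousOn (sP Q 0 n) UU := by
  unfold sP
  refine continuousOn_finsetSum _ fun i hi => ?_
  have hi' := (Finset.mem_Ico.1 hi).2
  intro z hz
  have h1 : ContinuousAt (rP Q i) z := by
    unfold rP
    exact (aeval_cont _).continuousAt.div (aeval_cont _).continuousAt
      (aeval_ne_UU hpos hne hi'.le hz)
  have h2 := Complex.continuousAt_arg (UU_slit (rP_UU hpos hr hi' hz))
  exact (ContinuousAt.comp (f := rP Q i) h2 h1).continuousWithinAt

/-- total argument defect -/
noncomputable def tP (n : ℕ) (Q : ℕ → ℝ[X]) (z : ℂ) : ℝ :=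
  sP Q 0 n z + sP Q 0 n (wP z) - Complex.arg z

include hpos hne hr in
lemma tP_cont : ContinuousOn (tP n Q) UU := by
  unfold tP
  have h := sP_cont hpos hne hr
  refine (h.add (h.comp ?_ fun z hz => wP_UU hz)).sub ?_
  · intro z hz
    unfold wP
    refine (ContinuousAt.inv₀ Complex.continuous_conj.continuousAt ?_).continuousWithinAt
    simpa using UU_ne hz
  · intro z hz
    exact (Complex.continuousAt_arg (UU_slit hz)).continuousWithinAt

lemma aeval_wP (p : ℝ[X]) (z : ℂ) : aeval (wP z) p = (starRingEnd ℂ) (aeval z⁻¹ p) := by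
  rw [← Polynomial.aeval_conj]
  simp [wP]

include hpos hne hQn hQ0 in
lemma tP_exp (hn : 1 ≤ n) {z : ℂ} (hz : z ∈ UU) : Complex.exp (tP n Q z * Complex.I) = 1 := by
  have hz0 := UU_ne hz
  obtain ⟨c, hc, e1⟩ := sP_exp hpos hne (Nat.zero_le n) le_rfl hz
  obtain ⟨c', hc', e2⟩ := sP_exp hpos hne (Nat.zero_le n) le_rfl (wP_UU hz)
  have hA := aeval_ne_UU hpos hne (Nat.zero_le n) hz
  have hB := aeval_ne_UU hpos hne (Nat.zero_le n) (wP_UU hz)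
  have hC := aeval_ne_UU hpos hne le_rfl hz
  have e3 := Complex.norm_mul_exp_arg_mul_I z
  have n1 := congrArg (starRingEnd ℂ) (hQn z hz0)
  have n2 := congrArg (starRingEnd ℂ) (hQ0 z hz0)
  rw [map_mul, ← aeval_wP, map_pow] at n1 n2
  have hcz : (starRingEnd ℂ) z ≠ 0 := by simpa using hz0
  set a := Complex.exp (sP Q 0 n z * Complex.I)
  set b := Complex.exp (sP Q 0 n (wP z) * Complex.I)
  set t := Complex.exp (Complex.arg z * Complex.I) with ht
  have ht0 : t ≠ 0 := Complex.exp_ne_zero _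
  have hE : Complex.exp (tP n Q z * Complex.I) = a * b / t := by
    unfold tP
    push_cast
    rw [sub_mul, add_mul, Complex.exp_sub, Complex.exp_add]
  -- z * conj z * (conj Q0 Q0) * a b c c' = z * Qn conj Qn
  have key : (((c * c' * Complex.normSq z * Complex.normSq (aeval z (Q 0)) : ℝ)) : ℂ) * (a * b) =
      ((Complex.normSq (aeval z (Q n)) * ‖z‖ : ℝ) : ℂ) * t := by
    have p1 : (starRingEnd ℂ) z ^ n = (starRingEnd ℂ) z ^ (n - 1) * (starRingEnd ℂ) z := by
      rw [← pow_succ]; congr 1; omega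
    push_cast
    rw [← Complex.mul_conj, ← Complex.mul_conj, ← Complex.mul_conj, ← n1, ← n2, p1, e1, e2]
    linear_combination (-(c * a * aeval z (Q 0) * ((starRingEnd ℂ) z ^ (n - 1) * (starRingEnd ℂ) z * (c' * b * aeval (wP z) (Q 0))))) * e3
  have hpos1 : 0 < c * c' * Complex.normSq z * Complex.normSq (aeval z (Q 0)) := by
    have := Complex.normSq_pos.2 hz0
    have := Complex.normSq_pos.2 hA
    positivity
  have hpos2 : 0 < Complex.normSq (aeval z (Q n)) * ‖z‖ := by
    have := Complex.normSq_pos.2 hC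
    positivity
  set α := c * c' * Complex.normSq z * Complex.normSq (aeval z (Q 0))
  set β := Complex.normSq (aeval z (Q n)) * ‖z‖
  have hα : (α : ℂ) ≠ 0 := by exact_mod_cast hpos1.ne'
  have h1 : Complex.exp (tP n Q z * Complex.I) = ((β / α : ℝ) : ℂ) := by
    rw [hE, div_eq_iff ht0]
    push_cast
    field_simp
    linear_combination key
  have h2 := Complex.norm_exp_ofReal_mul_I (tP n Q z)
  rw [h1, Complex.norm_real, Real.norm_of_nonneg (by positivity)] at h2
  rw [h1, h2]; simp

include hpos hne hr hQn hQ0 in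
lemma tP_zero (hn : 1 ≤ n) {z : ℂ} (hz : z ∈ UU) : tP n Q z = 0 := by
  have h1U : (1 : ℂ) ∈ UU := by right; simp
  have hs : sP Q 0 n 1 = 0 := by
    refine Finset.sum_eq_zero fun i hi => ?_
    have hi' := (Finset.mem_Ico.1 hi).2
    obtain ⟨c, hc, e⟩ := aeval_real_pos hpos hi'.le (z := 1) (by simp) (by simp)
    obtain ⟨c', hc', e'⟩ := aeval_real_pos hpos (Nat.succ_le_of_lt hi') (z := 1) (by simp) (by simp)
    unfold rP
    rw [e, e', ← Complex.ofReal_div]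
    exact Complex.arg_ofReal_of_nonneg (by positivity)
  have h1 : tP n Q 1 = 0 := by
    have : wP 1 = 1 := by simp [wP]
    simp [tP, this, hs]
  have hconn := UU_convex.isPreconnected
  have hc := tP_cont hpos hne hr
  have hnot : ∀ w ∈ UU, ∀ s : ℝ, tP n Q w = s → Complex.exp (s * Complex.I) = 1 := by
    intro w hw s hs
    rw [← hs]; exact tP_exp hpos hne hQn hQ0 hn hw
  obtain ⟨l, hl⟩ := Complex.exp_eq_one_iff.1 (tP_exp hpos hne hQn hQ0 hn hz)
  have hl' : tP n Q z = l * (2 * Real.pi) := by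
    have h := congrArg Complex.im hl
    simpa using h
  have hpi := Real.pi_pos
  rcases lt_trichotomy l 0 with h | h | h
  · exfalso
    have hl1 : (l : ℝ) ≤ -1 := by exact_mod_cast (by omega : l ≤ -1)
    obtain ⟨w, hw, hw'⟩ := hconn.intermediate_value hz h1U hc
      (show -Real.pi ∈ Set.Icc (tP n Q z) (tP n Q 1) from ⟨by rw [hl']; nlinarith, by rw [h1]; linarith⟩)
    have := hnot w hw _ hw'
    rw [Complex.ofReal_neg, neg_mul, Complex.exp_neg, Complex.exp_pi_mul_I] at this
    norm_num at this
  · rw [hl', h]; simp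
  · exfalso
    have hl1 : (1 : ℝ) ≤ l := by exact_mod_cast (by omega : 1 ≤ l)
    obtain ⟨w, hw, hw'⟩ := hconn.intermediate_value h1U hz hc
      (show Real.pi ∈ Set.Icc (tP n Q 1) (tP n Q z) from ⟨by rw [h1]; linarith, by rw [hl']; nlinarith⟩)
    have := hnot w hw _ hw'
    rw [Complex.exp_pi_mul_I] at this
    norm_num at this

include hpos hne hr hQn hQ0 in
lemma chain_pair (hn : 1 ≤ n) {j k : ℕ} (hjk : j ≤ k) (hk : k ≤ n) {z : ℂ} (hz : z ∈ UU) :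
    ∃ t ∈ UU, aeval z (Q k) = t * aeval z (Q j) := by
  obtain ⟨c, hc, e⟩ := sP_exp hpos hne hjk hk hz
  refine ⟨_, UU_of_exp hc (sP_nonneg hpos hr hk hz) ?_, e⟩
  have h1 := tP_zero hpos hne hr hQn hQ0 hn hz
  have h2 := sP_le hpos hr (j := j) hk hz
  have h3 := sP_nonneg hpos hr (j := 0) le_rfl (wP_UU hz)
  have h4 := (UU_arg hz).2
  unfold tP at h1
  linarith

include hpos hne hr hQn hQ0 in
lemma chain_rev (hn : 1 ≤ n) {j k : ℕ} (hj : j ≤ n) (hk : k ≤ n) {z : ℂ} (hz : z ∈ UU) :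
    ∃ t ∈ UU, z ^ n * aeval z⁻¹ (Q j) = t * aeval z (Q k) := by
  have hz0 := UU_ne hz
  obtain ⟨c, hc, e1⟩ := sP_exp hpos hne hk le_rfl hz
  obtain ⟨c', hc', e2⟩ := sP_exp hpos hne hj le_rfl (wP_UU hz)
  have hφ0 : 0 ≤ sP Q k n z + sP Q j n (wP z) :=
    add_nonneg (sP_nonneg hpos hr le_rfl hz) (sP_nonneg hpos hr le_rfl (wP_UU hz))
  have hφ1 : sP Q k n z + sP Q j n (wP z) < Real.pi := by
    have h1 := tP_zero hpos hne hr hQn hQ0 hn hz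
    have h2 := sP_le hpos hr (j := k) le_rfl hz
    have h3 := sP_le hpos hr (j := j) le_rfl (wP_UU hz)
    have h4 := (UU_arg hz).2
    unfold tP at h1
    linarith
  refine ⟨_, UU_of_exp (div_pos hc hc') hφ0 hφ1, ?_⟩
  have e3 := congrArg (starRingEnd ℂ) e2
  rw [aeval_wP, aeval_wP, Complex.conj_conj, map_mul, map_mul, Complex.conj_conj,
    Complex.conj_ofReal, ← Complex.exp_conj, map_mul, Complex.conj_ofReal, Complex.conj_I,
    mul_neg, Complex.exp_neg] at e3
  have e4 := hQn z hz0
  rw [e3, e1] at e4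
  have hc0 : (c' : ℂ) ≠ 0 := by exact_mod_cast hc'.ne'
  have hx0 := Complex.exp_ne_zero (sP Q j n (wP z) * Complex.I)
  push_cast
  rw [add_mul, Complex.exp_add]
  field_simp at e4 ⊢
  linear_combination e4

end chain

/-! ### Assembly -/

lemma UU_add {z w : ℂ} (hz : z ∈ UU) (hw : w ∈ UU) : z + w ∈ UU := by
  simp only [UU, Set.mem_ofPred_eq, Complex.add_im, Complex.add_re] at *
  rcases hz with hz | ⟨hz, hz'⟩ <;> rcases hw with hw | ⟨hw, hw'⟩
  · left; positivity
  · left; linarith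
  · left; linarith
  · right; exact ⟨by linarith, by linarith⟩

lemma UU_smul {z : ℂ} (hz : z ∈ UU) {c : ℝ} (hc : 0 < c) : (c : ℂ) * z ∈ UU := by
  simp only [UU, Set.mem_ofPred_eq, Complex.im_ofReal_mul, Complex.re_ofReal_mul] at *
  rcases hz with hz | ⟨hz, hz'⟩
  · left; positivity
  · right; exact ⟨by rw [hz]; simp, by positivity⟩

lemma UU_im {z : ℂ} (hz : z ∈ UU) : 0 ≤ z.im := by
  rcases hz with h | ⟨h, _⟩
  · exact h.le
  · exact h.ge

lemma UU_sum (s : Finset ℕ) (c : ℕ → ℝ) (hc : ∀ k, 0 ≤ c k) (t : ℕ → ℂ) (ht : ∀ k ∈ s, t k ∈ UU) :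
    (∀ k ∈ s, c k = 0) ∨ ∑ k ∈ s, (c k : ℂ) * t k ∈ UU := by
  induction s using Finset.induction_on with
  | empty => left; simp
  | insert a s ha ih =>
    rw [Finset.sum_insert ha]
    have hta := ht a (Finset.mem_insert_self a s)
    rcases ih (fun k hk => ht k (Finset.mem_insert_of_mem hk)) with h | h
    · have h0 : ∑ k ∈ s, (c k : ℂ) * t k = 0 :=
        Finset.sum_eq_zero fun k hk => by rw [h k hk]; simp
      rw [h0, add_zero]
      rcases (hc a).eq_or_lt with h1 | h1
      · left
        intro k hk
        rcases Finset.mem_insert.1 hk with rfl | hk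
        · exact h1.symm
        · exact h k hk
      · right; exact UU_smul hta h1
    · right
      rcases (hc a).eq_or_lt with h1 | h1
      · rw [← h1]; simpa using h
      · exact UU_add (UU_smul hta h1) h

lemma interlaces_of (p q : ℝ[X]) (h0 : ∀ z : ℂ, 0 < z.im → aeval z p ≠ 0)
    (h : ∀ z : ℂ, 0 < z.im → ∃ t : ℂ, 0 ≤ t.im ∧ (toC q).eval z = t * aeval z p) :
    Interlaces p q := by
  right
  intro z hz he
  obtain ⟨t, ht, e⟩ := h z hz
  rw [eval_add, eval_mul, eval_C, e, toC_eval, ← add_mul, mul_eq_zero] at he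
  rcases he with he | he
  · have := congrArg Complex.im he
    simp at this
    linarith
  · exact h0 z hz he

lemma im_sum_inv_nonpos (s : Finset ℕ) (c : ℕ → ℝ) (hc : ∀ k, 0 ≤ c k) (t : ℕ → ℂ)
    (ht : ∀ k ∈ s, t k ∈ UU) : (∑ k ∈ s, (c k : ℂ) * (t k)⁻¹).im ≤ 0 := by
  rw [Complex.im_sum]
  refine Finset.sum_nonpos fun k hk => ?_
  rw [Complex.im_ofReal_mul]
  have := im_inv_nonpos (UU_im (ht k hk))
  have := hc k
  nlinarith

lemma ratio_of_all (s : Finset ℕ) (c : ℕ → ℝ) (hc : ∀ k, 0 ≤ c k) (v : ℕ → ℂ) (y : ℂ)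
    (h : ∀ k ∈ s, ∃ t ∈ UU, y = t * v k) (hF : ∑ k ∈ s, (c k : ℂ) * v k ≠ 0) :
    ∃ t : ℂ, 0 ≤ t.im ∧ y = t * ∑ k ∈ s, (c k : ℂ) * v k := by
  choose! t ht e using h
  have h1 : ∑ k ∈ s, (c k : ℂ) * v k = (∑ k ∈ s, (c k : ℂ) * (t k)⁻¹) * y := by
    rw [Finset.sum_mul]
    refine Finset.sum_congr rfl fun k hk => ?_
    have h2 := UU_ne (ht k hk)
    rw [e k hk]
    field_simp
  refine ⟨(∑ k ∈ s, (c k : ℂ) * (t k)⁻¹)⁻¹, im_inv_nonneg (im_sum_inv_nonpos s c hc t ht), ?_⟩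
  have h3 : ∑ k ∈ s, (c k : ℂ) * (t k)⁻¹ ≠ 0 := by
    intro h4; rw [h1, h4, zero_mul] at hF; exact hF rfl
  rw [h1, ← mul_assoc, inv_mul_cancel₀ h3, one_mul]

lemma eval_reflect (n : ℕ) (f : ℝ[X]) (hf : f.natDegree ≤ n) (z : ℂ) (hz : z ≠ 0) :
    (toC (reflect n f)).eval z = z ^ n * aeval z⁻¹ f := by
  letI : Invertible (z⁻¹) := invertibleOfNonzero (inv_ne_zero hz)
  have h := eval₂_reflect_mul_pow (algebraMap ℝ ℂ) z⁻¹ n f hf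
  rw [invOf_eq_inv, inv_inv] at h
  rw [toC, eval_map, aeval_def, ← h, inv_pow]
  have := pow_ne_zero n hz
  field_simp

lemma Dmap_comb (n : ℕ) (c : ℕ → ℝ) :
    Dmap (∑ k ∈ Finset.range (n + 1), Polynomial.C (c k) * X ^ k * (X + 1) ^ (n - k)) =
      ∑ k ∈ Finset.range (n + 1), c k • gP (n - k) k := by
  rw [Dmap_eq, map_sum]
  refine Finset.sum_congr rfl fun k _ => ?_
  unfold gP
  rw [← map_smul, Polynomial.smul_eq_C_mul, mul_assoc]

lemma realRooted_of (f : ℝ[X]) (h : ∀ z : ℂ, 0 < z.im → aeval z f ≠ 0) : RealRooted f := by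
  right
  intro z hz
  rw [toC_eval] at hz
  rcases lt_trichotomy z.im 0 with h1 | h1 | h1
  · exfalso
    apply h ((starRingEnd ℂ) z) (by simpa using h1)
    rw [Polynomial.aeval_conj, hz, map_zero]
  · exact h1
  · exact absurd hz (h z h1)

lemma main_big (n : ℕ) (hn : 2 ≤ n) (c : ℕ → ℝ) (hc : ∀ k, 0 ≤ c k) (f : ℝ[X])
    (hf : f = ∑ k ∈ Finset.range (n + 1), c k • gP (n - k) k) :
    RealRooted f ∧
    Interlaces (eulerianPoly n) f ∧
    Interlaces f (derangePoly n) ∧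
    Interlaces f (Polynomial.reflect n f) ∧
    Interlaces (eulerianPoly n) (derangePoly n) := by
  set Q : ℕ → ℝ[X] := fun k => gP (n - k) k with hQ
  have hgood : ∀ k ≤ n, GoodP (Q k) := fun k hk => (pkP_main (n - k) k (by omega)).1
  have hpos : ∀ k ≤ n, ∀ x : ℝ, 0 < x → 0 < (Q k).eval x := fun k hk x hx =>
    eval_pos_of_nonneg (hgood k hk).1 (hgood k hk).ne_zero hx
  have hne : ∀ k ≤ n, ∀ z : ℂ, 0 < z.im → aeval z (Q k) ≠ 0 := fun k hk => (hgood k hk).2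
  have hr : ∀ k < n, ∀ z : ℂ, 0 < z.im → 0 < (aeval z (Q (k + 1)) / aeval z (Q k)).im ∨
      aeval z (Q (k + 1)) / aeval z (Q k) = 1 := by
    intro k hk z hz
    have := consec (n - (k + 1)) k (by omega) z hz
    rwa [show n - (k + 1) + 1 = n - k by omega] at this
  have hQn' : Q n = derangePoly n := by simp only [hQ]; rw [Nat.sub_self, gP_zero_left]
  have hQ0' : Q 0 = eulerianPoly n := by simp only [hQ]; rw [Nat.sub_zero, gP_zero_right]
  have hQn : ∀ z : ℂ, z ≠ 0 → z ^ n * aeval z⁻¹ (Q n) = aeval z (Q n) := by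
    intro z hz
    rw [hQn', ← toC_eval, ← toC_eval]
    exact derange_palin n z hz
  have hQ0 : ∀ z : ℂ, z ≠ 0 → z ^ (n - 1) * aeval z⁻¹ (Q 0) = aeval z (Q 0) := by
    intro z hz
    obtain ⟨m, rfl⟩ : ∃ m, n = m + 1 := ⟨n - 1, by omega⟩
    rw [hQ0', ← toC_eval, ← toC_eval]
    exact eulerian_palin m z hz
  have pair := fun {j k : ℕ} (hjk : j ≤ k) (hk : k ≤ n) {z : ℂ} (hz : z ∈ UU) =>
    chain_pair hpos hne hr hQn hQ0 (by omega) hjk hk hz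
  have rev := fun {j k : ℕ} (hj : j ≤ n) (hk : k ≤ n) {z : ℂ} (hz : z ∈ UU) =>
    chain_rev hpos hne hr hQn hQ0 (by omega) hj hk hz
  have hfz : ∀ z : ℂ, aeval z f = ∑ k ∈ Finset.range (n + 1), (c k : ℂ) * aeval z (Q k) := by
    intro z
    rw [hf, map_sum]
    refine Finset.sum_congr rfl fun k _ => ?_
    rw [map_smul, Complex.real_smul]
  have hmem : ∀ k ∈ Finset.range (n + 1), k ≤ n := fun k hk =>
    Nat.lt_succ_iff.1 (Finset.mem_range.1 hk)
  have hfs : ∀ z : ℂ, 0 < z.im → ∃ t : ℂ, aeval z f = t * aeval z (Q 0) ∧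
      (((∀ k ∈ Finset.range (n + 1), c k = 0) ∧ t = 0) ∨ t ∈ UU) := by
    intro z hz
    have := fun k (hk : k ∈ Finset.range (n + 1)) =>
      pair (Nat.zero_le k) (hmem k hk) (show z ∈ UU from Or.inl hz)
    choose! t ht e using this
    refine ⟨∑ k ∈ Finset.range (n + 1), (c k : ℂ) * t k, ?_, ?_⟩
    · rw [hfz, Finset.sum_mul]
      exact Finset.sum_congr rfl fun k hk => by rw [e k hk]; ring
    · rcases UU_sum _ c hc t ht with h | h
      · exact Or.inl ⟨h, Finset.sum_eq_zero fun k hk => by rw [h k hk]; simp⟩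
      · exact Or.inr h
  have hdeg : f.natDegree ≤ n := by
    rw [hf]
    refine natDegree_sum_le_of_forall_le _ _ fun k hk => ?_
    refine le_trans (natDegree_smul_le _ _) ?_
    have := hmem k hk
    exact le_trans (gP_natDegree (n - k) k (by omega)) (by omega)
  have hAd : Interlaces (eulerianPoly n) (derangePoly n) := by
    rw [← hQ0', ← hQn']
    refine interlaces_of _ _ (hne 0 (by omega)) fun z hz => ?_
    obtain ⟨t, ht, e⟩ := pair (Nat.zero_le n) le_rfl (show z ∈ UU from Or.inl hz)
    exact ⟨t, UU_im ht, by rw [toC_eval, e]⟩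
  have hAf : Interlaces (eulerianPoly n) f := by
    rw [← hQ0']
    refine interlaces_of _ _ (hne 0 (by omega)) fun z hz => ?_
    obtain ⟨t, e, ht⟩ := hfs z hz
    refine ⟨t, ?_, by rw [toC_eval, e]⟩
    rcases ht with ⟨_, rfl⟩ | ht
    · simp
    · exact UU_im ht
  by_cases hall : ∀ k ∈ Finset.range (n + 1), c k = 0
  · have hf0 : f = 0 := by
      rw [hf]; exact Finset.sum_eq_zero fun k hk => by rw [hall k hk, zero_smul]
    refine ⟨Or.inl hf0, hAf, ?_, ?_, hAd⟩
    · right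
      intro z hz
      rw [hf0, ← hQn']
      have := hne n le_rfl z hz
      rw [← toC_eval] at this
      simpa [toC] using this
    · left
      rw [hf0]; simp [toC]
  · have hfne : ∀ z : ℂ, 0 < z.im → aeval z f ≠ 0 := by
      intro z hz
      obtain ⟨t, e, ht⟩ := hfs z hz
      rw [e]
      rcases ht with ⟨h, _⟩ | ht
      · exact absurd h hall
      · exact mul_ne_zero (UU_ne ht) (hne 0 (by omega) z hz)
    refine ⟨realRooted_of f hfne, hAf, ?_, ?_, hAd⟩
    · refine interlaces_of _ _ hfne fun z hz => ?_
      rw [toC_eval, ← hQn', hfz]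
      refine ratio_of_all _ c hc (fun k => aeval z (Q k)) _ (fun k hk => ?_) ?_
      · exact pair (hmem k hk) le_rfl (Or.inl hz)
      · rw [← hfz]; exact hfne z hz
    · refine interlaces_of _ _ hfne fun z hz => ?_
      have hz0 : z ≠ 0 := UU_ne (Or.inl hz)
      rw [eval_reflect n f hdeg z hz0]
      have h1 : ∀ j ∈ Finset.range (n + 1), ∃ t : ℂ, 0 ≤ t.im ∧
          z ^ n * aeval z⁻¹ (Q j) = t * aeval z f := by
        intro j hj
        rw [hfz]
        refine ratio_of_all _ c hc (fun k => aeval z (Q k)) _ (fun k hk => ?_) ?_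
        · exact rev (hmem j hj) (hmem k hk) (Or.inl hz)
        · rw [← hfz]; exact hfne z hz
      choose! t ht e using h1
      refine ⟨∑ j ∈ Finset.range (n + 1), (c j : ℂ) * t j, ?_, ?_⟩
      · rw [Complex.im_sum]
        refine Finset.sum_nonneg fun j hj => ?_
        rw [Complex.im_ofReal_mul]
        exact mul_nonneg (hc j) (ht j hj)
      · rw [hfz z⁻¹, Finset.mul_sum, Finset.sum_mul]
        refine Finset.sum_congr rfl fun j hj => ?_
        rw [mul_assoc, ← e j hj]; ring

lemma main_small (n : ℕ) (hn : n ≤ 1) (a : ℝ) (ha : 0 ≤ a) (d : ℝ[X])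
    (hd : d = 1 ∨ d = 0) :
    RealRooted (C a) ∧
    Interlaces 1 (C a) ∧
    Interlaces (C a) d ∧
    Interlaces (C a) (Polynomial.reflect n (C a)) ∧
    Interlaces 1 d := by
  have h1 : Interlaces 1 (C a) := by
    refine interlaces_of _ _ (by simp) fun z _ => ⟨a, by simp, by simp [toC]⟩
  have h2 : Interlaces 1 d := by
    refine interlaces_of _ _ (by simp) fun z _ => ?_
    rcases hd with rfl | rfl
    · exact ⟨1, by simp, by simp [toC]⟩
    · exact ⟨0, by simp, by simp [toC]⟩
  rcases ha.eq_or_lt with h | h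
  · rw [← h] at h1 ⊢
    rw [C_0] at h1 ⊢
    refine ⟨Or.inl rfl, h1, ?_, ?_, h2⟩
    · rcases hd with rfl | rfl
      · right; intro z _; simp [toC]
      · left; simp [toC]
    · left; simp [toC]
  · have hne : ∀ z : ℂ, 0 < z.im → aeval z (C a) ≠ 0 := by
      intro z _
      simpa using h.ne'
    have hac : (a : ℂ) ≠ 0 := by exact_mod_cast h.ne'
    refine ⟨realRooted_of _ hne, h1, ?_, ?_, h2⟩
    · refine interlaces_of _ _ hne fun z _ => ?_
      rcases hd with rfl | rfl
      · refine ⟨((a⁻¹ : ℝ) : ℂ), by simp only [Complex.ofReal_im, le_refl], ?_⟩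
        simp [toC, hac]
      · exact ⟨0, by simp, by simp [toC]⟩
    · refine interlaces_of _ _ hne fun z hz => ?_
      have hz0 : z ≠ 0 := UU_ne (Or.inl hz)
      rw [eval_reflect n _ (by simp) z hz0]
      refine ⟨z ^ n, ?_, by simp⟩
      rcases (show n = 0 ∨ n = 1 by omega) with rfl | rfl
      · simp
      · simpa using hz.le

/-- if `p = Σ_k c_k x^k (x+1)^{n-k}` with `c_k ≥ 0`, then `D(p)` is
real-rooted, `A_n ≺ D(p) ≺ d_n`, and `D(p) ≺ I_n(D(p))`; in particular `A_n ≺ d_n`. -/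
theorem stmt15 (n : ℕ) (c : ℕ → ℝ) (hc : ∀ k, 0 ≤ c k)
    (p : ℝ[X])
    (hp : p = ∑ k ∈ Finset.range (n + 1), Polynomial.C (c k) * X ^ k * (X + 1) ^ (n - k)) :
    RealRooted (Dmap p) ∧
    Interlaces (eulerianPoly n) (Dmap p) ∧
    Interlaces (Dmap p) (derangePoly n) ∧
    Interlaces (Dmap p) (Polynomial.reflect n (Dmap p)) ∧
    Interlaces (eulerianPoly n) (derangePoly n) := by
  subst hp
  rw [Dmap_comb]
  rcases (show n = 0 ∨ n = 1 ∨ 2 ≤ n by omega) with rfl | rfl | hn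
  · have e : ∑ k ∈ Finset.range (0 + 1), c k • gP (0 - k) k = C (c 0) := by
      simp [gP_zero_left, derange_zero, Polynomial.smul_eq_C_mul]
    rw [e, eulerian_zero]
    exact main_small 0 (by omega) (c 0) (hc 0) _ (Or.inl derange_zero)
  · have e : ∑ k ∈ Finset.range (1 + 1), c k • gP (1 - k) k = C (c 0) := by
      simp [Finset.sum_range_succ, gP_zero_left, gP_zero_right, eulerian_one, derange_one,
        Polynomial.smul_eq_C_mul]
    rw [e, eulerian_one]
    exact main_small 1 le_rfl (c 0) (hc 0) _ (Or.inr derange_one)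
  · exact main_big n hn c hc _ rfl
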